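/- Suppose additionally that f is bounded above, i.e. f^* := sup_x f(x) < +∞, and set Δ_* = f^* − f_*. There is an absolute constant C > 0 such that, under assumptions (A1)–(A4), for every T ≥ 1 the AdaGrad-Norm iterates satisfy E[(1/T)∑_{t=1}^T ‖∇f(x_t)‖₂] ≤ C·( A/√T + √(B·‖σ‖_p)/T^{(p−1)/(2p)} ), where A = √(λΔ_*/γ) + Δ_*/γ + γ‖L‖_∞ and B = Δ_*/γ + γ‖L‖_∞. -/

import Mathlib

open MeasureTheory Finset

/-- The AdaGrad-Norm accumulator `v_t = ∑_{s=1}^t ‖g_s‖₂²`. -/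
noncomputable def adaNormV {Ω : Type} {d : ℕ} (g : ℕ → Ω → EuclideanSpace ℝ (Fin d))
    (t : ℕ) (ω : Ω) : ℝ :=
  ∑ s ∈ Finset.Icc 1 t, ‖g s ω‖ ^ 2

/-- The natural filtration `F_t = σ(g_1, …, g_t)`. -/
noncomputable def natFilt {Ω : Type} [MeasurableSpace Ω] {d : ℕ}
    (g : ℕ → Ω → EuclideanSpace ℝ (Fin d)) (t : ℕ) : MeasurableSpace Ω :=
  ⨆ s ∈ Finset.Icc 1 t, MeasurableSpace.comap (g s) inferInstance

/-- Telescoping the descent inequality of AdaGrad-Norm against the increasing weights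
`lam + √(∑ n_s²)`, for an objective bounded above by `M`. -/
lemma adaNorm_sum_inner_le {γ lam K M : ℝ} (hγ : 0 < γ) (hlam : 0 < lam) (hK : 0 ≤ K)
    (I F n : ℕ → ℝ) (hF : ∀ t, F t ≤ M)
    (hdesc : ∀ t, 1 ≤ t → F (t + 1) ≤ F t - γ / (lam + √(∑ s ∈ Icc 1 t, n s ^ 2)) * I t
      + K / 2 * ((γ / (lam + √(∑ s ∈ Icc 1 t, n s ^ 2))) ^ 2 * n t ^ 2)) (T : ℕ) :
    ∑ t ∈ Icc 1 T, I t ≤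
      (lam + √(∑ s ∈ Icc 1 T, n s ^ 2)) * (M - F (T + 1)) / γ
        + γ * K * √(∑ s ∈ Icc 1 T, n s ^ 2) := by
  induction T with
  | zero =>
    have := mul_nonneg hlam.le (sub_nonneg.2 (hF 1))
    simpa using div_nonneg this hγ.le
  | succ T ih =>
    have hd := hdesc (T + 1) (by omega)
    have hv0 : 0 ≤ ∑ s ∈ Icc 1 T, n s ^ 2 := sum_nonneg fun _ _ => sq_nonneg _
    rw [sum_Icc_succ_top (by omega)] at hd ⊢
    rw [sum_Icc_succ_top (by omega)]
    set v := ∑ s ∈ Icc 1 T, n s ^ 2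
    set m := n (T + 1)
    have hle : √v ≤ √(v + m ^ 2) := Real.sqrt_le_sqrt (by nlinarith [sq_nonneg m])
    have h1 := Real.sq_sqrt hv0
    have h2 := Real.sq_sqrt (show 0 ≤ v + m ^ 2 by positivity)
    set a := √v
    set b := √(v + m ^ 2)
    have ha0 : 0 ≤ a := Real.sqrt_nonneg _
    have hc : 0 < lam + b := by positivity
    have hI : I (T + 1) ≤ (lam + b) * (F (T + 1) - F (T + 1 + 1)) / γ
        + γ * K / 2 * (m ^ 2 / (lam + b)) := by
      have h := mul_le_mul_of_nonneg_left hd (div_nonneg hc.le hγ.le)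
      have e : (lam + b) / γ * (F (T + 1) - γ / (lam + b) * I (T + 1)
          + K / 2 * ((γ / (lam + b)) ^ 2 * m ^ 2))
          = (lam + b) / γ * F (T + 1) - I (T + 1) + γ * K / 2 * (m ^ 2 / (lam + b)) := by
        field_simp
      rw [e] at h
      have e' : (lam + b) * (F (T + 1) - F (T + 1 + 1)) / γ
        = (lam + b) / γ * F (T + 1) - (lam + b) / γ * F (T + 1 + 1) := by ring
      linarith
    have hm : m ^ 2 / (lam + b) ≤ 2 * (b - a) := by
      rw [div_le_iff₀ hc]
      nlinarith [mul_nonneg (sub_nonneg.2 hle) (sub_nonneg.2 hle),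
        mul_nonneg (sub_nonneg.2 hle) hlam.le]
    have hm' := mul_le_mul_of_nonneg_left hm (show 0 ≤ γ * K / 2 by positivity)
    have hF' : (lam + a) * (M - F (T + 1)) / γ ≤ (lam + b) * (M - F (T + 1)) / γ :=
      div_le_div_of_nonneg_right
        (mul_le_mul_of_nonneg_right (by linarith) (sub_nonneg.2 (hF _))) hγ.le
    have e : (lam + b) * (M - F (T + 1 + 1)) / γ = (lam + b) * (M - F (T + 1)) / γ
      + (lam + b) * (F (T + 1) - F (T + 1 + 1)) / γ := by ring
    linarith

/-- The `ℓ²` norm is bounded by the `ℓᵖ` norm for `p ≤ 2`. -/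
lemma sqrt_sum_sq_le_rpow_sum {ι : Type*} (s : Finset ι) (a : ι → ℝ) {p : ℝ} (hp : 0 < p)
    (hp2 : p ≤ 2) : √(∑ i ∈ s, a i ^ 2) ≤ (∑ i ∈ s, |a i| ^ p) ^ (1 / p) := by
  have h : (∑ i ∈ s, a i ^ 2) ^ (p / 2) ≤ ∑ i ∈ s, (a i ^ 2) ^ (p / 2) :=
    le_sum_of_subadditive_on_pred (fun y : ℝ => y ^ (p / 2)) (fun y => 0 ≤ y)
      (by rw [Real.zero_rpow (by positivity)])
      (fun x y hx hy => Real.rpow_add_le_add_rpow hx hy (by positivity) (by linarith))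
      (fun x y hx hy => add_nonneg hx hy) _ (fun i _ => sq_nonneg _)
  have e : ∀ i, (a i ^ 2) ^ (p / 2) = |a i| ^ p := fun i => by
    rw [← sq_abs, ← Real.rpow_natCast, ← Real.rpow_mul (abs_nonneg _)]
    congr 1
    push_cast
    ring
  simp only [e] at h
  have h0 : 0 ≤ ∑ i ∈ s, a i ^ 2 := sum_nonneg fun _ _ => sq_nonneg _
  calc √(∑ i ∈ s, a i ^ 2) = ((∑ i ∈ s, a i ^ 2) ^ (p / 2)) ^ (1 / p) := by
        rw [Real.sqrt_eq_rpow, ← Real.rpow_mul h0]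
        congr 1
        field_simp
    _ ≤ _ := Real.rpow_le_rpow (by positivity) h (by positivity)

/-- A bounded smooth function has bounded gradient. -/
lemma norm_sq_grad_le {d : ℕ} {f : EuclideanSpace ℝ (Fin d) → ℝ}
    {gradf : EuclideanSpace ℝ (Fin d) → EuclideanSpace ℝ (Fin d)} {K Δ : ℝ} (hK : 0 ≤ K)
    (hΔ : ∀ u v, f u - f v ≤ Δ)
    (hsm : ∀ u v, f u ≤ f v + inner ℝ (gradf v) (u - v) + K / 2 * ‖u - v‖ ^ 2)
    (v : EuclideanSpace ℝ (Fin d)) : ‖gradf v‖ ^ 2 ≤ 2 * (K + 1) * Δ := by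
  have h := hsm (v - (1 / (K + 1)) • gradf v) v
  have h' := hΔ v (v - (1 / (K + 1)) • gradf v)
  have e : v - (1 / (K + 1)) • gradf v - v = -((1 / (K + 1)) • gradf v) := by abel
  rw [e, inner_neg_right, real_inner_smul_right, real_inner_self_eq_norm_sq, norm_neg,
    norm_smul, mul_pow, Real.norm_eq_abs, sq_abs] at h
  have hk : 0 < K + 1 := by linarith
  have hN := sq_nonneg ‖gradf v‖
  set N := ‖gradf v‖ ^ 2
  set c := 1 / (K + 1) with hc
  have hc0 : 0 < c := by positivity
  have hcK : c * (K + 1) = 1 := by rw [hc]; field_simp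
  have h1 : c * N - K / 2 * (c ^ 2 * N) ≤ Δ := by linarith
  have h2 : K / 2 * (c ^ 2 * N) ≤ c * N / 2 := by
    have : c * K ≤ 1 := by nlinarith
    nlinarith [mul_nonneg hc0.le hN, mul_le_mul_of_nonneg_right this (mul_nonneg hc0.le hN)]
  have h3 : c * N ≤ 2 * Δ := by linarith
  calc N = (K + 1) * (c * N) := by rw [← mul_assoc, mul_comm (K + 1), hcK, one_mul]
    _ ≤ (K + 1) * (2 * Δ) := mul_le_mul_of_nonneg_left h3 hk.le
    _ = _ := by ring

/-- Jensen's inequality for `y ↦ y ^ q` with `0 ≤ q ≤ 1`, with the integrability of the power. -/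
lemma integral_rpow_le_rpow_integral {Ω : Type*} [MeasurableSpace Ω] {μ : Measure Ω}
    [IsProbabilityMeasure μ] {R : Ω → ℝ} (hR : Integrable R μ) (hR0 : ∀ ω, 0 ≤ R ω) {q : ℝ}
    (hq : 0 ≤ q) (hq1 : q ≤ 1) :
    Integrable (fun ω => R ω ^ q) μ ∧ ∫ ω, R ω ^ q ∂μ ≤ (∫ ω, R ω ∂μ) ^ q := by
  have hi : Integrable (fun ω => R ω ^ q) μ := by
    refine ((integrable_const (1 : ℝ)).add hR).mono'
      ((Real.continuous_rpow_const hq).comp_aestronglyMeasurable hR.1) (ae_of_all _ fun ω => ?_)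
    rw [Real.norm_of_nonneg (Real.rpow_nonneg (hR0 ω) q)]
    simp only [Pi.add_apply]
    rcases le_total (R ω) 1 with h | h
    · linarith [Real.rpow_le_one (hR0 ω) h hq, hR0 ω]
    · linarith [(Real.rpow_le_rpow_of_exponent_le h hq1).trans_eq (Real.rpow_one (R ω))]
  exact ⟨hi, (Real.concaveOn_rpow hq hq1).le_map_integral
    (Real.continuous_rpow_const hq).continuousOn isClosed_Ici (ae_of_all _ hR0) hR hi⟩

lemma sq_integral_le_integral_sq {Ω : Type*} [MeasurableSpace Ω] {μ : Measure Ω}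
    [IsProbabilityMeasure μ] {Z : Ω → ℝ} (hZ : Integrable Z μ)
    (hZ2 : Integrable (fun ω => Z ω ^ 2) μ) : (∫ ω, Z ω ∂μ) ^ 2 ≤ ∫ ω, Z ω ^ 2 ∂μ := by
  set c := ∫ ω, Z ω ∂μ with hc
  have h : 0 ≤ ∫ ω, (Z ω ^ 2 - 2 * c * Z ω + c ^ 2) ∂μ :=
    integral_nonneg fun ω => (sq_nonneg (Z ω - c)).trans_eq (by ring)
  have hi : Integrable (fun ω => Z ω ^ 2 - 2 * c * Z ω) μ := hZ2.sub (hZ.const_mul _)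
  rw [integral_add hi (integrable_const _), integral_sub hZ2 (hZ.const_mul _),
    integral_const_mul, ← hc, integral_const, probReal_univ, one_smul] at h
  nlinarith

lemma integral_mul_condExp_eq {Ω : Type*} {m m₀ : MeasurableSpace Ω} {μ : Measure Ω}
    [IsProbabilityMeasure μ] (hm : m ≤ m₀) {X Y : Ω → ℝ} (hX : Integrable X μ)
    (hXY : μ[X | m] =ᵐ[μ] Y) (hYX : Integrable (fun ω => Y ω * X ω) μ) :
    ∫ ω, Y ω * X ω ∂μ = ∫ ω, Y ω ^ 2 ∂μ := by
  have hY : AEStronglyMeasurable[m] Y μ := ⟨_, stronglyMeasurable_condExp, hXY.symm⟩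
  have h := condExp_mul_of_aestronglyMeasurable_left (m := m) hY hYX hX
  calc ∫ ω, Y ω * X ω ∂μ = ∫ ω, (μ[Y * X | m]) ω ∂μ := (integral_condExp hm).symm
    _ = _ := integral_congr_ae (by
      filter_upwards [h, hXY] with ω h1 h2
      rw [h1, Pi.mul_apply, h2, sq])

lemma natFilt_le {Ω : Type} [m₀ : MeasurableSpace Ω] {d : ℕ}
    {g : ℕ → Ω → EuclideanSpace ℝ (Fin d)} (hg : ∀ t, Measurable (g t)) (t : ℕ) :
    natFilt g t ≤ m₀ :=
  iSup₂_le fun s _ => (hg s).comap_le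

lemma le_of_sq_le_add_mul {y a b : ℝ} (ha : 0 ≤ a) (hb : 0 ≤ b) (h : y ^ 2 ≤ a + b * y) :
    y ≤ √a + b := by
  by_contra! hlt
  nlinarith [Real.sq_sqrt ha, Real.sqrt_nonneg a,
    mul_nonneg (Real.sqrt_nonneg a) hb]

lemma sqrt_sum_norm_sq_le {d : ℕ} (T : ℕ) (u w : ℕ → EuclideanSpace ℝ (Fin d)) {p : ℝ}
    (hp : 0 < p) (hp2 : p ≤ 2) :
    √(∑ t ∈ Icc 1 T, ‖u t‖ ^ 2) ≤ 2 * (√(∑ t ∈ Icc 1 T, ‖w t‖ ^ 2)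
      + (∑ t ∈ Icc 1 T, ∑ i, |u t i - w t i| ^ p) ^ (1 / p)) := by
  have hW := sqrt_sum_sq_le_rpow_sum (Icc 1 T ×ˢ (univ : Finset (Fin d)))
    (fun q => u q.1 q.2 - w q.1 q.2) hp hp2
  rw [sum_product, sum_product] at hW
  have e : ∀ t, ∑ i, (u t i - w t i) ^ 2 = ‖u t - w t‖ ^ 2 := fun t => by
    simp [EuclideanSpace.norm_sq_eq]
  simp only [e] at hW
  refine le_trans ?_ (mul_le_mul_of_nonneg_left (add_le_add_right hW _) zero_le_two)
  have ha : 0 ≤ ∑ t ∈ Icc 1 T, ‖w t‖ ^ 2 := sum_nonneg fun _ _ => sq_nonneg _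
  have hb : 0 ≤ ∑ t ∈ Icc 1 T, ‖u t - w t‖ ^ 2 := sum_nonneg fun _ _ => sq_nonneg _
  refine Real.sqrt_le_iff.2 ⟨by positivity, ?_⟩
  have h : ∑ t ∈ Icc 1 T, ‖u t‖ ^ 2 ≤ ∑ t ∈ Icc 1 T, (2 * ‖w t‖ ^ 2 + 2 * ‖u t - w t‖ ^ 2) := by
    refine sum_le_sum fun t _ => ?_
    have h1 : ‖u t‖ ≤ ‖w t‖ + ‖u t - w t‖ := by
      simpa using norm_add_le (w t) (u t - w t)
    nlinarith [norm_nonneg (u t), sq_nonneg (‖w t‖ - ‖u t - w t‖)]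
  rw [sum_add_distrib, ← mul_sum, ← mul_sum] at h
  nlinarith [Real.sq_sqrt ha, Real.sq_sqrt hb,
    mul_nonneg (Real.sqrt_nonneg (∑ t ∈ Icc 1 T, ‖w t‖ ^ 2))
      (Real.sqrt_nonneg (∑ t ∈ Icc 1 T, ‖u t - w t‖ ^ 2))]

lemma mean_norm_le {E : Type*} [NormedAddCommGroup E] {T : ℕ} (hT : 1 ≤ T) (w : ℕ → E) :
    1 / (T : ℝ) * ∑ t ∈ Icc 1 T, ‖w t‖ ≤ 1 / √T * √(∑ t ∈ Icc 1 T, ‖w t‖ ^ 2) := by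
  have h := sq_sum_le_card_mul_sum_sq (s := Icc 1 T) (f := fun t => ‖w t‖)
  rw [Nat.card_Icc, Nat.add_sub_cancel] at h
  have h' := Real.le_sqrt_of_sq_le h
  have hT0 : (0 : ℝ) < T := by exact_mod_cast hT
  rw [Real.sqrt_mul hT0.le] at h'
  calc _ ≤ 1 / (T : ℝ) * (√T * √(∑ t ∈ Icc 1 T, ‖w t‖ ^ 2)) :=
        mul_le_mul_of_nonneg_left h' (by positivity)
    _ = _ := by
      rw [← mul_assoc]
      congr 1
      have := Real.sq_sqrt hT0.le
      have := Real.sqrt_pos.2 hT0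
      field_simp
      linarith

/-- Solving the quadratic inequality `y² ≤ a + 2B (y + (T s)^{1/p})` and dividing by `√T`. -/
lemma rate_of_sq_le {T : ℕ} (hT : 1 ≤ T) {y a B s p : ℝ} (ha : 0 ≤ a) (hB : 0 ≤ B)
    (hs : 0 ≤ s) (hp : 0 < p) (h : y ^ 2 ≤ a + 2 * B * (y + (T * s) ^ (1 / p))) :
    1 / √T * y ≤ 2 * ((√a + B) / √T + √(B * s ^ (1 / p)) / (T : ℝ) ^ ((p - 1) / (2 * p))) := by
  have hT0 : (0 : ℝ) < T := by exact_mod_cast hT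
  have hsT : 0 < √(T : ℝ) := Real.sqrt_pos.2 hT0
  have hS : 0 ≤ (T * s) ^ (1 / p) := by positivity
  have h1 : y ≤ √(a + 2 * B * (T * s) ^ (1 / p)) + 2 * B :=
    le_of_sq_le_add_mul (by positivity) (by positivity) (by linarith)
  have h2 : √(a + 2 * B * (T * s) ^ (1 / p)) ≤ √a + 2 * √(B * (T * s) ^ (1 / p)) := by
    refine Real.sqrt_le_iff.2 ⟨by positivity, ?_⟩
    have hBS : 0 ≤ B * (T * s) ^ (1 / p) := by positivity
    nlinarith [Real.sq_sqrt ha, Real.sq_sqrt hBS, mul_nonneg (Real.sqrt_nonneg a)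
      (Real.sqrt_nonneg (B * (T * s) ^ (1 / p)))]
  have h3 : √(B * (T * s) ^ (1 / p)) / √T
      = √(B * s ^ (1 / p)) / (T : ℝ) ^ ((p - 1) / (2 * p)) := by
    have e1 : B * (T * s) ^ (1 / p) = (T : ℝ) ^ (1 / p) * (B * s ^ (1 / p)) := by
      rw [Real.mul_rpow hT0.le hs]
      ring
    have e2 : √((T : ℝ) ^ (1 / p)) * (T : ℝ) ^ ((p - 1) / (2 * p)) = √T := by
      rw [Real.sqrt_eq_rpow, Real.sqrt_eq_rpow, ← Real.rpow_mul hT0.le, ← Real.rpow_add hT0]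
      congr 1
      field_simp
      ring
    have hpos : 0 < (T : ℝ) ^ ((p - 1) / (2 * p)) := Real.rpow_pos_of_pos hT0 _
    rw [div_eq_div_iff hsT.ne' hpos.ne', e1, Real.sqrt_mul (by positivity), ← e2]
    ring
  rw [← h3, one_div_mul_eq_div, ← add_div, ← mul_div_assoc]
  refine div_le_div_of_nonneg_right ?_ hsT.le
  linarith [Real.sqrt_nonneg a]

/-- convergence of AdaGrad-Norm for bounded objectives.  There is
an absolute constant `C > 0` such that, under (A1)–(A4) and `sup f < ∞`, for
every `T ≥ 1`,
`E[(1/T)∑_{t=1}^T ‖∇f(x_t)‖₂] ≤ C(A/√T + √(B‖σ‖_p)/T^{(p−1)/(2p)})`,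
where `Δ_* = sup f − inf f`, `A = √(λΔ_*/γ) + Δ_*/γ + γ‖L‖_∞` and
`B = Δ_*/γ + γ‖L‖_∞`. -/
theorem adagradNorm_bounded_objective_rate :
    ∃ C : ℝ, 0 < C ∧
    ∀ (d : ℕ) (Ω : Type) [MeasurableSpace Ω] (μ : Measure Ω) [IsProbabilityMeasure μ]
      (f : EuclideanSpace ℝ (Fin d) → ℝ)
      (gradf : EuclideanSpace ℝ (Fin d) → EuclideanSpace ℝ (Fin d))
      (g x : ℕ → Ω → EuclideanSpace ℝ (Fin d)) (x₁ : EuclideanSpace ℝ (Fin d))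
      (γ lam p : ℝ) (L σ : Fin d → ℝ),
      0 < γ → 0 < lam →
      (∀ y, HasGradientAt f (gradf y) y) →
      -- (A1) lower boundedness
      BddBelow (Set.range f) →
      -- additional assumption for Statements 2/3: boundedness above (omitted in 5)
      BddAbove (Set.range f) →
      -- (A2) coordinate-wise smoothness
      (∀ i, 0 < L i) →
      (∀ u v : EuclideanSpace ℝ (Fin d),
        |f u - f v - ∑ i, gradf v i * (u i - v i)| ≤ 1 / 2 * ∑ i, L i * (u i - v i) ^ 2) →
      (∀ t, Measurable (g t)) →
      (∀ t, Integrable (g t) μ) →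
      -- AdaGrad-Norm dynamics
      (∀ ω, x 1 ω = x₁) →
      (∀ t, 1 ≤ t → ∀ ω,
        x (t + 1) ω = x t ω - (γ / (lam + Real.sqrt (adaNormV g t ω))) • g t ω) →
      -- (A3) unbiasedness
      (∀ t, 1 ≤ t → ∀ i : Fin d,
        μ[(fun ω => g t ω i) | natFilt g (t - 1)] =ᵐ[μ] fun ω => gradf (x t ω) i) →
      -- (A4) heavy-tailed noise
      1 < p → p ≤ 2 → (∀ i, 0 ≤ σ i) →
      (∀ t, 1 ≤ t → ∀ i : Fin d,
        Integrable (fun ω => |g t ω i - gradf (x t ω) i| ^ p) μ ∧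
        ∀ᵐ ω ∂μ,
          (μ[(fun ω' => |g t ω' i - gradf (x t ω') i| ^ p) | natFilt g (t - 1)]) ω ≤ σ i ^ p) →
      ∀ T : ℕ, 1 ≤ T →
      (∫ ω, (1 / (T : ℝ)) * ∑ t ∈ Finset.Icc 1 T, ‖gradf (x t ω)‖ ∂μ) ≤
        C * ((Real.sqrt (lam * ((⨆ y, f y) - ⨅ y, f y) / γ) +
                ((⨆ y, f y) - ⨅ y, f y) / γ + γ * (⨆ i, L i)) / Real.sqrt (T : ℝ) +
              Real.sqrt ((((⨆ y, f y) - ⨅ y, f y) / γ + γ * (⨆ i, L i)) *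
                (∑ i, σ i ^ p) ^ (1 / p)) / (T : ℝ) ^ ((p - 1) / (2 * p))) := by
  refine ⟨2, two_pos, ?_⟩
  intro d Ω _ μ _ f gradf g x x₁ γ lam p L σ hγ hlam _ hbelow habove hL hsmooth hgm hgi _ hx hA3
    hp1 hp2 hσ hA4 T hT
  set Δ := (⨆ y, f y) - ⨅ y, f y with hΔdef
  set K := ⨆ i, L i with hKdef
  have hK : 0 ≤ K := Real.iSup_nonneg fun i => (hL i).le
  have hLK : ∀ i, L i ≤ K := fun i => le_ciSup (Set.finite_range L).bddAbove i
  have hfM : ∀ y, f y ≤ ⨆ y, f y := le_ciSup habove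
  have hfm : ∀ y, ⨅ y, f y ≤ f y := ciInf_le hbelow
  have hΔ : ∀ u v, f u - f v ≤ Δ := fun u v => sub_le_sub (hfM u) (hfm v)
  have hΔ0 : 0 ≤ Δ := by simpa using hΔ x₁ x₁
  have hp0 : 0 < p := by linarith
  have hsm : ∀ u v, f u ≤ f v + inner ℝ (gradf v) (u - v) + K / 2 * ‖u - v‖ ^ 2 := by
    intro u v
    have h := (abs_le.1 (hsmooth u v)).2
    have e : inner ℝ (gradf v) (u - v) = ∑ i, gradf v i * (u i - v i) := by
      simp [PiLp.inner_apply, mul_comm]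
    have h' : ∑ i, L i * (u i - v i) ^ 2 ≤ K * ‖u - v‖ ^ 2 := by
      rw [EuclideanSpace.norm_sq_eq, mul_sum]
      refine sum_le_sum fun i _ => ?_
      simpa using mul_le_mul_of_nonneg_right (hLK i) (sq_nonneg (u i - v i))
    rw [e]
    linarith
  have hgrad := norm_sq_grad_le hK hΔ hsm
  have hcoord : ∀ y i, ‖gradf y i‖ ≤ √(2 * (K + 1) * Δ) := fun y i =>
    (PiLp.norm_apply_le _ _).trans (Real.le_sqrt_of_sq_le (hgrad y))
  set B := Δ / γ + γ * K with hBdef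
  have hB : 0 ≤ B := by positivity
  set Z : Ω → ℝ := fun ω => √(∑ t ∈ Icc 1 T, ‖gradf (x t ω)‖ ^ 2) with hZdef
  set R : Ω → ℝ := fun ω => ∑ t ∈ Icc 1 T, ∑ i, |g t ω i - gradf (x t ω) i| ^ p with hRdef
  have hgint : ∀ t i, Integrable (fun ω => g t ω i) μ := fun t i =>
    (EuclideanSpace.proj (𝕜 := ℝ) i).integrable_comp (hgi t)
  have hDm : ∀ t, 1 ≤ t → ∀ i, AEStronglyMeasurable (fun ω => gradf (x t ω) i) μ :=
    fun t ht i => integrable_condExp.1.congr (hA3 t ht i)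
  have hDg : ∀ t, 1 ≤ t → ∀ i, Integrable (fun ω => gradf (x t ω) i * g t ω i) μ :=
    fun t ht i => (hgint t i).bdd_mul (hDm t ht i) (ae_of_all _ fun ω => hcoord _ i)
  have hD2 : ∀ t, 1 ≤ t → ∀ i, Integrable (fun ω => gradf (x t ω) i ^ 2) μ := by
    intro t ht i
    refine Integrable.of_bound ((hDm t ht i).pow 2) (√(2 * (K + 1) * Δ) ^ 2)
      (ae_of_all _ fun ω => ?_)
    rw [norm_pow]
    exact pow_le_pow_left₀ (norm_nonneg _) (hcoord _ i) 2
  have hZsq : ∀ ω, Z ω ^ 2 = ∑ t ∈ Icc 1 T, ∑ i, gradf (x t ω) i ^ 2 := fun ω => by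
    rw [hZdef, Real.sq_sqrt (sum_nonneg fun _ _ => sq_nonneg _)]
    simp [EuclideanSpace.norm_sq_eq]
  have hZ2 : Integrable (fun ω => Z ω ^ 2) μ := by
    simp only [hZsq]
    exact integrable_finsetSum _ fun t ht => integrable_finsetSum _ fun i _ =>
      hD2 t (mem_Icc.1 ht).1 i
  have hZ0 : ∀ ω, 0 ≤ Z ω := fun ω => Real.sqrt_nonneg _
  have hZ : Integrable Z μ := by
    have hm : AEStronglyMeasurable Z μ := by
      have := Real.continuous_sqrt.comp_aestronglyMeasurable hZ2.1
      simpa only [Real.sqrt_sq (hZ0 _)] using this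
    refine ((integrable_const (1 : ℝ)).add hZ2).mono' hm (ae_of_all _ fun ω => ?_)
    rw [Real.norm_of_nonneg (hZ0 ω), Pi.add_apply]
    nlinarith [sq_nonneg (Z ω - 1), hZ0 ω]
  have hR : Integrable R μ := integrable_finsetSum _ fun t ht => integrable_finsetSum _ fun i _ =>
    (hA4 t (mem_Icc.1 ht).1 i).1
  have hR0 : ∀ ω, 0 ≤ R ω := fun ω => sum_nonneg fun _ _ => sum_nonneg fun _ _ =>
    Real.rpow_nonneg (abs_nonneg _) _
  have hER : ∫ ω, R ω ∂μ ≤ T * ∑ i, σ i ^ p := by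
    rw [hRdef, integral_finsetSum _ fun t ht => integrable_finsetSum _ fun i _ =>
      (hA4 t (mem_Icc.1 ht).1 i).1]
    have h : ∀ t ∈ Icc 1 T, ∫ ω, ∑ i, |g t ω i - gradf (x t ω) i| ^ p ∂μ ≤ ∑ i, σ i ^ p := by
      intro t ht
      have ht := (mem_Icc.1 ht).1
      rw [integral_finsetSum _ fun i _ => (hA4 t ht i).1]
      refine sum_le_sum fun i _ => ?_
      rw [← integral_condExp (natFilt_le hgm (t - 1))]
      simpa using integral_mono_ae integrable_condExp (integrable_const _) (hA4 t ht i).2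
    simpa using sum_le_sum h
  obtain ⟨hRq, hJensen⟩ := integral_rpow_le_rpow_integral hR hR0 (q := 1 / p) (by positivity)
    (by rw [div_le_one hp0]; exact hp1.le)
  have hpath : ∀ ω, ∑ t ∈ Icc 1 T, ∑ i, gradf (x t ω) i * g t ω i
      ≤ lam * Δ / γ + 2 * B * (Z ω + R ω ^ (1 / p)) := by
    intro ω
    have h := adaNorm_sum_inner_le hγ hlam hK (fun t => ∑ i, gradf (x t ω) i * g t ω i)
      (fun t => f (x t ω)) (fun t => ‖g t ω‖) (fun t => hfM _) (by
        intro t ht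
        have h := hsm (x (t + 1) ω) (x t ω)
        have hsub : x (t + 1) ω - x t ω
            = -((γ / (lam + √(∑ s ∈ Icc 1 t, ‖g s ω‖ ^ 2))) • g t ω) := by
          rw [hx t ht ω, adaNormV]
          abel
        rw [hsub, inner_neg_right, real_inner_smul_right, norm_neg, norm_smul, mul_pow,
          Real.norm_eq_abs, sq_abs] at h
        have e : inner ℝ (gradf (x t ω)) (g t ω) = ∑ i, gradf (x t ω) i * g t ω i := by
          simp [PiLp.inner_apply, mul_comm]
        rw [e] at h
        linarith) T
    have hv := sqrt_sum_norm_sq_le T (fun t => g t ω) (fun t => gradf (x t ω)) hp0 hp2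
    have hv0 : 0 ≤ √(∑ t ∈ Icc 1 T, ‖g t ω‖ ^ 2) := Real.sqrt_nonneg _
    set V := √(∑ t ∈ Icc 1 T, ‖g t ω‖ ^ 2)
    have h1 : (lam + V) * ((⨆ y, f y) - f (x (T + 1) ω)) / γ ≤ (lam + V) * Δ / γ :=
      div_le_div_of_nonneg_right (mul_le_mul_of_nonneg_left
        (sub_le_sub_left (hfm _) _) (by positivity)) hγ.le
    have h2 := mul_le_mul_of_nonneg_left hv hB
    have e : (lam + V) * Δ / γ + γ * K * V = lam * Δ / γ + B * V := by
      rw [hBdef]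
      ring
    have e' : 2 * B * (Z ω + R ω ^ (1 / p)) = B * (2 * (Z ω + R ω ^ (1 / p))) := by ring
    rw [e']
    exact h.trans (by linarith)
  have hEZ : ∫ ω, Z ω ^ 2 ∂μ
      ≤ lam * Δ / γ + 2 * B * (∫ ω, Z ω ∂μ + (T * ∑ i, σ i ^ p) ^ (1 / p)) := by
    have hsum : ∀ t ∈ Icc 1 T, Integrable (fun ω => ∑ i, gradf (x t ω) i * g t ω i) μ :=
      fun t ht => integrable_finsetSum _ fun i _ => hDg t (mem_Icc.1 ht).1 i
    have hZR : Integrable (fun ω => 2 * B * (Z ω + R ω ^ (1 / p))) μ :=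
      (hZ.add hRq).const_mul (2 * B)
    have hmono := integral_mono (integrable_finsetSum _ hsum)
      ((integrable_const (lam * Δ / γ)).add hZR) hpath
    have e1 : ∫ ω, ∑ t ∈ Icc 1 T, ∑ i, gradf (x t ω) i * g t ω i ∂μ = ∫ ω, Z ω ^ 2 ∂μ := by
      simp only [hZsq]
      rw [integral_finsetSum _ hsum, integral_finsetSum _ fun t ht =>
        integrable_finsetSum _ fun i _ => hD2 t (mem_Icc.1 ht).1 i]
      refine sum_congr rfl fun t ht => ?_
      have ht := (mem_Icc.1 ht).1
      rw [integral_finsetSum _ fun i _ => hDg t ht i, integral_finsetSum _ fun i _ => hD2 t ht i]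
      exact sum_congr rfl fun i _ => integral_mul_condExp_eq (natFilt_le hgm (t - 1))
        (hgint t i) (hA3 t ht i) (hDg t ht i)
    have e2 : ∫ ω, (lam * Δ / γ + 2 * B * (Z ω + R ω ^ (1 / p))) ∂μ
        = lam * Δ / γ + 2 * B * (∫ ω, Z ω ∂μ + ∫ ω, R ω ^ (1 / p) ∂μ) := by
      rw [integral_add (integrable_const _) hZR, integral_const_mul, integral_add hZ hRq]
      simp
    rw [← e1]
    refine (hmono.trans_eq e2).trans ?_
    have h := hJensen.trans (Real.rpow_le_rpow (integral_nonneg hR0) hER (by positivity))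
    gcongr
  have hy := rate_of_sq_le hT (by positivity) hB
    (sum_nonneg fun i _ => Real.rpow_nonneg (hσ i) p) hp0
    ((sq_integral_le_integral_sq hZ hZ2).trans hEZ)
  rw [← integral_const_mul] at hy
  rw [add_assoc (√(lam * Δ / γ))]
  refine le_trans ?_ hy
  exact integral_mono_of_nonneg (ae_of_all _ fun ω => by positivity) (hZ.const_mul _)
    (ae_of_all _ fun ω => mean_norm_le hT _)
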